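/- Let R be a Gorenstein local ring of dimension d > 1 and fix an integer n with 0 < n < d. Let X be the subcategory of finitely generated modules satisfying Serre's condition (S̃_n). Then X equals the subcategory of n-th syzygy modules, X is resolving, X strictly contains the totally reflexive modules, and Ω⁻ⁱX ⊆ X for all i ≥ d. -/

import Mathlib

open CategoryTheory

noncomputable section

namespace Paper

variable (R : Type) [CommRing R]

/-- finitely generated projective module (object of `add R`) -/
def FGProj (M : ModuleCat.{0} R) : Prop := Module.Finite R M ∧ Module.Projective R M

/-- a short exact sequence `0 → L → M → N → 0` -/
def SES {L M N : ModuleCat.{0} R} (f : L →ₗ[R] M) (g : M →ₗ[R] N) : Prop :=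
  Function.Injective f ∧ Function.Surjective g ∧ LinearMap.ker g = LinearMap.range f

/-- `N` is a first syzygy of `M`: kernel of a surjection from a f.g. projective onto `M`. -/
def IsSyzygy (N M : ModuleCat.{0} R) : Prop :=
  ∃ (P : ModuleCat.{0} R) (f : P →ₗ[R] M), FGProj R P ∧ Function.Surjective f ∧
    Nonempty (N ≃ₗ[R] LinearMap.ker f)

/-- `N` is an `n`-th syzygy of `M` -/
def IsNthSyzygy : ℕ → ModuleCat.{0} R → ModuleCat.{0} R → Prop
  | 0, N, M => Nonempty (N ≃ₗ[R] M)
  | (n+1), N, M => ∃ K : ModuleCat.{0} R, IsNthSyzygy n K M ∧ IsSyzygy R N K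

/-- `f : M → P` is a left `add R`-approximation -/
def IsLeftApprox {M P : ModuleCat.{0} R} (f : M →ₗ[R] P) : Prop :=
  FGProj R P ∧ ∀ (Q : ModuleCat.{0} R), FGProj R Q → ∀ g : M →ₗ[R] Q,
    ∃ h : P →ₗ[R] Q, h.comp f = g

/-- `N` is a first cosyzygy of `M`: cokernel of a left `add R`-approximation. -/
def IsCosyzygy (N M : ModuleCat.{0} R) : Prop :=
  ∃ (P : ModuleCat.{0} R) (f : M →ₗ[R] P), IsLeftApprox R f ∧
    Nonempty (N ≃ₗ[R] (P ⧸ LinearMap.range f))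

/-- `N` is an `n`-th cosyzygy of `M` -/
def IsNthCosyzygy : ℕ → ModuleCat.{0} R → ModuleCat.{0} R → Prop
  | 0, N, M => Nonempty (N ≃ₗ[R] M)
  | (n+1), N, M => ∃ K : ModuleCat.{0} R, IsNthCosyzygy n K M ∧ IsCosyzygy R N K

/-- `T` is an (Auslander) transpose of `M` -/
def IsTranspose (T M : ModuleCat.{0} R) : Prop :=
  ∃ (P₁ P₀ : ModuleCat.{0} R) (d : P₁ →ₗ[R] P₀) (p : P₀ →ₗ[R] M),
    FGProj R P₁ ∧ FGProj R P₀ ∧ Function.Surjective p ∧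
    LinearMap.ker p = LinearMap.range d ∧
    Nonempty (T ≃ₗ[R] ((Module.Dual R P₁) ⧸ LinearMap.range d.dualMap))

/-- stably isomorphic: `M ⊕ P ≅ N ⊕ Q` with `P`, `Q` f.g. projective -/
def StablyIso (M N : ModuleCat.{0} R) : Prop :=
  ∃ P Q : ModuleCat.{0} R, FGProj R P ∧ FGProj R Q ∧
    Nonempty ((M × P) ≃ₗ[R] (N × Q))

/-- resolving subcategory of `mod R` -/
structure Resolving (X : ModuleCat.{0} R → Prop) : Prop where
  fg : ∀ M, X M → Module.Finite R M
  proj : ∀ M : ModuleCat.{0} R, FGProj R M → X M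
  summand : ∀ M N N' : ModuleCat.{0} R, X M → Nonempty (M ≃ₗ[R] N × N') → X N
  extension : ∀ (L M N : ModuleCat.{0} R) (f : L →ₗ[R] M) (g : M →ₗ[R] N),
      SES R f g → X L → X N → X M
  ker_epi : ∀ (L M N : ModuleCat.{0} R) (f : L →ₗ[R] M) (g : M →ₗ[R] N),
      SES R f g → X M → X N → X L

/-- `Ext^i_R(M, N) = 0` -/
def ExtVanish (M N : ModuleCat.{0} R) (i : ℕ) : Prop :=
  Subsingleton (((Ext R (ModuleCat.{0} R) i).obj (Opposite.op M)).obj N)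

/-- totally reflexive (Gorenstein dimension zero) module -/
def TotallyReflexive (M : ModuleCat.{0} R) : Prop :=
  Function.Bijective (Module.Dual.eval R M) ∧
  ∀ i : ℕ, 0 < i → ExtVanish R M (ModuleCat.of R R) i ∧
    ExtVanish R (ModuleCat.of R (Module.Dual R M)) (ModuleCat.of R R) i

/-- `M` has finite projective dimension -/
def FiniteProjDim (M : ModuleCat.{0} R) : Prop :=
  ∃ (n : ℕ) (N : ModuleCat.{0} R), IsNthSyzygy R n N M ∧ FGProj R N

/-- additive closure of a family of modules -/
def AddClosure (S : ModuleCat.{0} R → Prop) (M : ModuleCat.{0} R) : Prop :=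
  ∃ (k : ℕ) (f : Fin k → ModuleCat.{0} R) (N : ModuleCat.{0} R),
    (∀ i, S (f i)) ∧ Nonempty ((M × N) ≃ₗ[R] ((i : Fin k) → f i))

/-- the operation `[−]`: `add` closure of `R` and all syzygies of modules of `Y` -/
def Bracket (Y : ModuleCat.{0} R → Prop) : ModuleCat.{0} R → Prop :=
  AddClosure R (fun N => FGProj R N ∨ ∃ (M : ModuleCat.{0} R) (i : ℕ), Y M ∧ IsNthSyzygy R i N M)

/-- `Y ∘ Z`: extensions of a module of `Z` by a module of `Y` -/
def ExtOf (Y Z : ModuleCat.{0} R → Prop) (M : ModuleCat.{0} R) : Prop :=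
  ∃ (A B : ModuleCat.{0} R) (f : A →ₗ[R] M) (g : M →ₗ[R] B), Y A ∧ Z B ∧ SES R f g

/-- the ball `[C]_n` of radius `n` centered at `C` -/
def Ball (C : ModuleCat.{0} R) : ℕ → ModuleCat.{0} R → Prop
  | 0 => fun _ => False
  | 1 => Bracket R (fun M => Nonempty (M ≃ₗ[R] C))
  | (n+2) => Bracket R (ExtOf R (Ball C (n+1)) (Bracket R (fun M => Nonempty (M ≃ₗ[R] C))))

/-- `X` has finite radius: `X ⊆ [C]_{n+1}` for some `C ∈ X`. -/
def FiniteRadius (X : ModuleCat.{0} R → Prop) : Prop :=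
  ∃ (C : ModuleCat.{0} R) (n : ℕ), X C ∧ ∀ M, X M → Ball R C (n + 1) M

/-- `depth_A M ≥ n`: there is a weakly `M`-regular sequence of length `n` in the maximal ideal -/
def DepthGE (A : Type) [CommRing A] [IsLocalRing A]
    (M : Type) [AddCommGroup M] [Module A M] (n : ℕ) : Prop :=
  ∃ rs : List A, rs.length = n ∧ (∀ x ∈ rs, x ∈ IsLocalRing.maximalIdeal A) ∧
    RingTheory.Sequence.IsWeaklyRegular M rs

/-- `M` is free at the prime `p` -/
def FreeAt (M : ModuleCat.{0} R) (p : PrimeSpectrum R) : Prop :=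
  Module.Free (Localization.AtPrime p.asIdeal) (LocalizedModule p.asIdeal.primeCompl M)

/-- locally free on the punctured spectrum of a local ring -/
def LocFreeOnPunctured [IsLocalRing R] (M : ModuleCat.{0} R) : Prop :=
  ∀ p : PrimeSpectrum R, p.asIdeal ≠ IsLocalRing.maximalIdeal R → FreeAt R M p

/-- a Gorenstein local ring: `R` has finite injective dimension over itself -/
def Gorenstein : Prop :=
  ∃ n : ℕ, ∀ i : ℕ, n < i → ∀ M : ModuleCat.{0} R, ExtVanish R M (ModuleCat.of R R) i

/-- the annihilator of the `i`-th local cohomology module `H^i_I(M)` -/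
def aa (I : Ideal R) (i : ℕ) (M : ModuleCat.{0} R) : Ideal R :=
  Module.annihilator R ((localCohomology I i).obj M)

/-- an Ulrich module over a CM local ring of dimension `d` -/
def Ulrich [IsLocalRing R] (d : ℕ) (U : ModuleCat.{0} R) : Prop :=
  Module.Finite R U ∧ DepthGE R U d ∧ ¬ Subsingleton U ∧
  ∃ xs : List R, xs.length = d ∧ (∀ x ∈ xs, x ∈ IsLocalRing.maximalIdeal R) ∧
    RingTheory.Sequence.IsWeaklyRegular U xs ∧
    (IsLocalRing.maximalIdeal R) • (⊤ : Submodule R U) = Ideal.ofList xs • ⊤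

end Paper

open Paper

/-- Serre's condition `(S̃_n)`: `depth M_p ≥ min{n, depth R_p}` for all primes `p`. -/
def SerreS (R : Type) [CommRing R] (n : ℕ) (M : ModuleCat.{0} R) : Prop :=
  ∀ (p : PrimeSpectrum R) (c : ℕ), c ≤ n →
    DepthGE (Localization.AtPrime p.asIdeal) (Localization.AtPrime p.asIdeal) c →
    DepthGE (Localization.AtPrime p.asIdeal) (LocalizedModule p.asIdeal.primeCompl M) c

namespace Hlp

/-- vanishing of `Ext^i(M, N)`, in terms of the derived-category version of `Ext` -/
def EZ (A : Type) [CommRing A] (M N : Type) [AddCommGroup M] [Module A M]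
    [AddCommGroup N] [Module A N] (i : ℕ) : Prop :=
  Subsingleton (Abelian.Ext.{0} (ModuleCat.of A M) (ModuleCat.of A N) i)

theorem extVanish_iff (R : Type) [CommRing R] (M N : ModuleCat.{0} R) (j : ℕ) :
    ExtVanish R M N (j+1) ↔ EZ R M N (j+1) := by
  let P : ProjectiveResolution M := projectiveResolution M
  have key : ExtVanish R M N (j+1) ↔
      ∀ f : P.complex.X (j+1) ⟶ N, P.complex.d (j+2) (j+1) ≫ f = 0 →
        ∃ g : P.complex.X j ⟶ N, P.complex.d (j+1) j ≫ g = f := by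
    unfold ExtVanish
    rw [(P.isoExt (R := R) (j+1) N).toLinearEquiv.toEquiv.subsingleton_congr,
      ← ModuleCat.isZero_iff_subsingleton,
      ← HomologicalComplex.exactAt_iff_isZero_homology,
      HomologicalComplex.exactAt_iff' _ j (j+1) (j+2) (by simp) (by simp),
      ShortComplex.moduleCat_exact_iff]
    rfl
  rw [key]
  constructor
  · intro h
    refine subsingleton_of_forall_eq 0 fun α => ?_
    obtain ⟨f, hf, rfl⟩ := P.extMk_surjective α (j+2) rfl
    rw [P.extMk_eq_zero_iff f (j+2) rfl hf j rfl]
    exact h f hf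
  · intro h f hf
    rw [← P.extMk_eq_zero_iff f (j+2) rfl hf j rfl]
    exact @Subsingleton.elim _ h _ _

section LES
variable {A : Type} [CommRing A] {L M N Y : Type} [AddCommGroup L] [Module A L]
  [AddCommGroup M] [Module A M] [AddCommGroup N] [Module A N] [AddCommGroup Y] [Module A Y]

theorem ses_shortExact {f : L →ₗ[A] M} {g : M →ₗ[A] N} (hf : Function.Injective f)
    (hfg : Function.Exact f g) (hg : Function.Surjective g) :
    (ShortComplex.mk (ModuleCat.ofHom f) (ModuleCat.ofHom g) (by
      ext x; exact (hfg (f x)).2 ⟨x, rfl⟩)).ShortExact :=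
  ModuleCat.shortComplex_shortExact _ hfg hf hg

/-- contravariant: middle term -/
theorem EZ.con2 {f : L →ₗ[A] M} {g : M →ₗ[A] N} (hf : Function.Injective f)
    (hfg : Function.Exact f g) (hg : Function.Surjective g) {i : ℕ}
    (h1 : EZ A L Y i) (h3 : EZ A N Y i) : EZ A M Y i := by
  refine subsingleton_of_forall_eq 0 fun α => ?_
  obtain ⟨β, rfl⟩ := Abelian.Ext.contravariant_sequence_exact₂ (ses_shortExact hf hfg hg)
    (ModuleCat.of A Y) α (@Subsingleton.elim _ h1 _ _)
  rw [@Subsingleton.elim _ h3 β 0]; simp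

/-- contravariant: left term -/
theorem EZ.con1 {f : L →ₗ[A] M} {g : M →ₗ[A] N} (hf : Function.Injective f)
    (hfg : Function.Exact f g) (hg : Function.Surjective g) {i : ℕ}
    (h2 : EZ A M Y i) (h3 : EZ A N Y (i+1)) : EZ A L Y i := by
  refine subsingleton_of_forall_eq 0 fun α => ?_
  obtain ⟨β, rfl⟩ := Abelian.Ext.contravariant_sequence_exact₁ (ses_shortExact hf hfg hg)
    (ModuleCat.of A Y) α (add_comm 1 i) (@Subsingleton.elim _ h3 _ _)
  rw [@Subsingleton.elim _ h2 β 0]; simp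

/-- contravariant: right term -/
theorem EZ.con3 {f : L →ₗ[A] M} {g : M →ₗ[A] N} (hf : Function.Injective f)
    (hfg : Function.Exact f g) (hg : Function.Surjective g) {i : ℕ}
    (h1 : EZ A L Y i) (h2 : EZ A M Y (i+1)) : EZ A N Y (i+1) := by
  refine subsingleton_of_forall_eq 0 fun α => ?_
  obtain ⟨β, rfl⟩ := Abelian.Ext.contravariant_sequence_exact₃ (ses_shortExact hf hfg hg)
    (ModuleCat.of A Y) α (@Subsingleton.elim _ h2 _ _) (add_comm 1 i)
  rw [@Subsingleton.elim _ h1 β 0]; simp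

/-- covariant: middle term -/
theorem EZ.cov2 {f : L →ₗ[A] M} {g : M →ₗ[A] N} (hf : Function.Injective f)
    (hfg : Function.Exact f g) (hg : Function.Surjective g) {i : ℕ}
    (h1 : EZ A Y L i) (h3 : EZ A Y N i) : EZ A Y M i := by
  refine subsingleton_of_forall_eq 0 fun α => ?_
  obtain ⟨β, rfl⟩ := Abelian.Ext.covariant_sequence_exact₂ (ModuleCat.of A Y)
    (ses_shortExact hf hfg hg) α (@Subsingleton.elim _ h3 _ _)
  rw [@Subsingleton.elim _ h1 β 0]; simp

/-- covariant: left term -/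
theorem EZ.cov1 {f : L →ₗ[A] M} {g : M →ₗ[A] N} (hf : Function.Injective f)
    (hfg : Function.Exact f g) (hg : Function.Surjective g) {i : ℕ}
    (h2 : EZ A Y M (i+1)) (h3 : EZ A Y N i) : EZ A Y L (i+1) := by
  refine subsingleton_of_forall_eq 0 fun α => ?_
  obtain ⟨β, rfl⟩ := Abelian.Ext.covariant_sequence_exact₁ (ModuleCat.of A Y)
    (ses_shortExact hf hfg hg) α (@Subsingleton.elim _ h2 _ _) rfl
  rw [@Subsingleton.elim _ h3 β 0]; simp

/-- covariant: right term -/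
theorem EZ.cov3 {f : L →ₗ[A] M} {g : M →ₗ[A] N} (hf : Function.Injective f)
    (hfg : Function.Exact f g) (hg : Function.Surjective g) {i : ℕ}
    (h2 : EZ A Y M i) (h1 : EZ A Y L (i+1)) : EZ A Y N i := by
  refine subsingleton_of_forall_eq 0 fun α => ?_
  obtain ⟨β, rfl⟩ := Abelian.Ext.covariant_sequence_exact₃ (ModuleCat.of A Y)
    (ses_shortExact hf hfg hg) α rfl (@Subsingleton.elim _ h1 _ _)
  rw [@Subsingleton.elim _ h2 β 0]; simp

theorem EZ.zero_iff : EZ A M N 0 ↔ Subsingleton (M →ₗ[A] N) := by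
  unfold EZ
  rw [(Abelian.Ext.addEquiv₀ (X := ModuleCat.of A M) (Y := ModuleCat.of A N)).toEquiv.subsingleton_congr]
  exact (ModuleCat.homAddEquiv (M := ModuleCat.of A M) (N := ModuleCat.of A N)).toEquiv.subsingleton_congr

theorem EZ.proj [Module.Projective A M] (i : ℕ) : EZ A M N (i+1) := by
  have : Projective (ModuleCat.of A M) := by
    rw [← IsProjective.iff_projective]; infer_instance
  exact subsingleton_of_forall_eq 0 fun α => Abelian.Ext.eq_zero_of_projective α

theorem EZ.of_subsingleton_left [Subsingleton M] (i : ℕ) : EZ A M N i := by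
  cases i with
  | zero => rw [EZ.zero_iff]; exact ⟨fun f g => by ext x; rw [Subsingleton.elim x 0]; simp⟩
  | succ i => exact EZ.proj i

theorem EZ.of_subsingleton_right [Subsingleton N] (i : ℕ) : EZ A M N i := by
  have h : Limits.IsZero (ModuleCat.of A N) := ModuleCat.isZero_of_subsingleton _
  refine subsingleton_of_forall_eq 0 fun α => ?_
  have := Abelian.Ext.comp_mk₀_id α
  rw [h.eq_of_src (𝟙 _) 0] at this
  rw [← this]; simp

theorem EZ.congr_left (e : L ≃ₗ[A] M) {i : ℕ} (h : EZ A L N i) : EZ A M N i :=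
  EZ.con2 (L := L) (M := M) (N := PUnit) (f := e.toLinearMap) (g := 0) e.injective
    (by intro x; simp) (fun x => ⟨0, rfl⟩) h (EZ.of_subsingleton_left i)

theorem EZ.congr_right (e : L ≃ₗ[A] M) {i : ℕ} (h : EZ A N L i) : EZ A N M i :=
  EZ.cov2 (L := L) (M := M) (N := PUnit) (f := e.toLinearMap) (g := 0) e.injective
    (by intro x; simp) (fun x => ⟨0, rfl⟩) h (EZ.of_subsingleton_right i)

/-- extension of maps -/
theorem EZ.extend {f : L →ₗ[A] M} {g : M →ₗ[A] N} (hf : Function.Injective f)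
    (hfg : Function.Exact f g) (hg : Function.Surjective g)
    (h3 : EZ A N Y 1) (φ : L →ₗ[A] Y) : ∃ ψ : M →ₗ[A] Y, ψ.comp f = φ := by
  obtain ⟨β, hβ⟩ := Abelian.Ext.contravariant_sequence_exact₁ (ses_shortExact hf hfg hg)
    (ModuleCat.of A Y) (Abelian.Ext.mk₀ (ModuleCat.ofHom φ)) (add_comm 1 0)
    (@Subsingleton.elim _ h3 _ _)
  obtain ⟨ψ, rfl⟩ := (Abelian.Ext.addEquiv₀).symm.surjective β
  refine ⟨ψ.hom, ?_⟩
  simp only [Abelian.Ext.addEquiv₀_symm_apply, Abelian.Ext.mk₀_comp_mk₀] at hβ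
  have := (Abelian.Ext.mk₀_bijective _ _).1 hβ
  exact ModuleCat.hom_ext_iff.1 this

theorem EZ.one_of_extend {f : L →ₗ[A] M} {g : M →ₗ[A] N} (hf : Function.Injective f)
    (hfg : Function.Exact f g) (hg : Function.Surjective g) (h2 : EZ A M Y 1)
    (h : ∀ φ : L →ₗ[A] Y, ∃ ψ : M →ₗ[A] Y, ψ.comp f = φ) : EZ A N Y 1 := by
  refine subsingleton_of_forall_eq 0 fun α => ?_
  obtain ⟨β, rfl⟩ := Abelian.Ext.contravariant_sequence_exact₃ (ses_shortExact hf hfg hg)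
    (ModuleCat.of A Y) α (@Subsingleton.elim _ h2 _ _) (add_comm 1 0)
  obtain ⟨φ, rfl⟩ := (Abelian.Ext.addEquiv₀).symm.surjective β
  obtain ⟨ψ, hψ⟩ := h φ.hom
  have e : φ = ModuleCat.ofHom f ≫ ModuleCat.ofHom ψ := by
    ext x; exact (LinearMap.congr_fun hψ x).symm
  rw [Abelian.Ext.addEquiv₀_symm_apply, e, ← Abelian.Ext.mk₀_comp_mk₀]
  exact (ses_shortExact hf hfg hg).extClass_comp_assoc _

/-- The Nakayama step. -/
theorem EZ.nakayama [IsNoetherianRing A] [IsLocalRing A] [Module.Finite A M] [Module.Finite A Y]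
    {x : A} (hx : x ∈ IsLocalRing.maximalIdeal A) (hreg : IsSMulRegular M x) {i : ℕ}
    (h : EZ A (QuotSMulTop x M) Y (i+1)) : EZ A M Y i := by
  have hS := IsSMulRegular.smulShortComplex_shortExact (M := ModuleCat.of A M) hreg
  have hsurj : ∀ α : Abelian.Ext.{0} (ModuleCat.of A M) (ModuleCat.of A Y) i,
      ∃ β, x • β = α := by
    intro α
    obtain ⟨β, hβ⟩ := Abelian.Ext.contravariant_sequence_exact₁ hS
      (ModuleCat.of A Y) α (add_comm 1 i) (@Subsingleton.elim _ h _ _)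
    refine ⟨β, ?_⟩
    rw [← hβ, ModuleCat.smulShortComplex_f_eq_smul_id]
    have e : ∀ γ : Abelian.Ext.{0} (ModuleCat.of A M) (ModuleCat.of A Y) i,
        (Abelian.Ext.mk₀ (x • 𝟙 (ModuleCat.of A M))).comp γ (zero_add i) = x • γ := by
      intro γ
      simp [Abelian.Ext.mk₀_smul]
    exact (e β).symm
  have : Module.Finite A (Abelian.Ext.{0} (ModuleCat.of A M) (ModuleCat.of A Y) i) :=
    ModuleCat.finite_ext A _ _ i
  have htop : (⊤ : Submodule A (Abelian.Ext.{0} (ModuleCat.of A M) (ModuleCat.of A Y) i)) = ⊥ := by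
    refine Submodule.eq_bot_of_le_smul_of_le_jacobson_bot (IsLocalRing.maximalIdeal A) _
      Module.Finite.fg_top ?_ (IsLocalRing.maximalIdeal_le_jacobson _)
    intro α _
    obtain ⟨β, rfl⟩ := hsurj α
    exact Submodule.smul_mem_smul hx trivial
  exact (Submodule.subsingleton_iff A).1 (subsingleton_of_bot_eq_top htop.symm)

end LES
end Hlp

namespace Hlp
section Depth
open RingTheory.Sequence IsLocalRing
open scoped Pointwise
set_option linter.unusedSectionVars false
variable {A : Type} [CommRing A] [IsNoetherianRing A] [IsLocalRing A]
  {M N : Type} [AddCommGroup M] [Module A M] [AddCommGroup N] [Module A N]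

theorem smul_lt [Module.Finite A M] [Nontrivial M] (I : Ideal A) (hI : I ≤ maximalIdeal A) :
    I • (⊤ : Submodule A M) < ⊤ :=
  lt_top_iff_ne_top.2 (Submodule.top_ne_ideal_smul_of_le_jacobson_annihilator
    (hI.trans (maximalIdeal_le_jacobson _))).symm

theorem supp_quot (I : Ideal A) : Module.support A (A ⧸ I) = PrimeSpectrum.zeroLocus (I : Set A) := by
  rw [Module.support_eq_zeroLocus, Ideal.annihilator_quotient]

theorem dg_trivial [Subsingleton M] (c : ℕ) : DepthGE A M c := by
  refine ⟨List.replicate c 0, by simp, fun x hx => ?_, ?_⟩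
  · rw [(List.mem_replicate.1 hx).2]; exact zero_mem _
  · exact ⟨fun i h => fun a b _ => Subsingleton.elim _ _⟩

theorem dg_iff [Module.Finite A M] (c : ℕ) :
    DepthGE A M c ↔ ∀ i < c, EZ A (A ⧸ maximalIdeal A) M i := by
  rcases subsingleton_or_nontrivial M with hM | hM
  · exact ⟨fun _ i _ => EZ.of_subsingleton_right i, fun _ => dg_trivial c⟩
  constructor
  · rintro ⟨rs, rfl, hmem, hreg⟩ i hi
    exact ModuleCat.subsingleton_ext_of_exists_isRegular (maximalIdeal A)
      (ModuleCat.of A (A ⧸ maximalIdeal A)) (supp_quot _).le (ModuleCat.of A M)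
      (smul_lt (M := M) _ le_rfl) rs hmem
      (IsRegular.of_isWeaklyRegular_of_mem_maximalIdeal M hmem hreg) i hi
  · intro h
    obtain ⟨rs, h1, h2, h3⟩ := ModuleCat.exists_isRegular_of_exists_subsingleton_ext
      (maximalIdeal A) c (ModuleCat.of A M) (smul_lt (M := M) _ le_rfl)
      (ModuleCat.of A (A ⧸ maximalIdeal A)) (supp_quot _) h
    exact ⟨rs, h1, h2, h3.1⟩

theorem dg_mono [Module.Finite A M] {c c' : ℕ} (h : c' ≤ c) (hc : DepthGE A M c) : DepthGE A M c' :=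
  (dg_iff c').2 fun i hi => (dg_iff c).1 hc i (hi.trans_le h)

theorem EZ.fin (Y : Type) [AddCommGroup Y] [Module A Y] {i : ℕ} (h : EZ A Y A i) (n : ℕ) :
    EZ A Y (Fin n → A) i := by
  induction n with
  | zero => exact EZ.of_subsingleton_right i
  | succ n ih =>
    refine EZ.congr_right (L := A × (Fin n → A)) (Fin.consLinearEquiv A (fun _ => A)) ?_
    exact EZ.cov2 (f := LinearMap.inl A A (Fin n → A)) (g := LinearMap.snd A A (Fin n → A))
      LinearMap.inl_injective Function.Exact.inl_snd LinearMap.snd_surjective h ih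

theorem EZ.free (Y : Type) [AddCommGroup Y] [Module A Y] {i : ℕ} (h : EZ A Y A i)
    [Module.Finite A M] [Module.Free A M] :
    EZ A Y M i :=
  EZ.congr_right (Module.finBasis A M).equivFun.symm (EZ.fin Y h _)

theorem dg_free [Module.Finite A M] [Module.Free A M] {c : ℕ} (h : DepthGE A A c) : DepthGE A M c :=
  (dg_iff c).2 fun i hi => EZ.free _ ((dg_iff c).1 h i hi)

/-- `A` has injective dimension at most `t` (tested on finite modules) -/
def ID (A : Type) [CommRing A] (t : ℕ) : Prop :=
  ∀ (M : Type) [AddCommGroup M] [Module A M] [Module.Finite A M] (i : ℕ), t < i → EZ A M A i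

theorem smulExact {x : A} (hx : IsSMulRegular M x) :
    Function.Injective (LinearMap.lsmul A M x) ∧
    Function.Exact (LinearMap.lsmul A M x) (Submodule.mkQ (x • (⊤ : Submodule A M))) ∧
    Function.Surjective (Submodule.mkQ (x • (⊤ : Submodule A M))) := by
  refine ⟨hx, ?_, Submodule.mkQ_surjective _⟩
  intro y
  rw [Submodule.mkQ_apply, Submodule.Quotient.mk_eq_zero, Submodule.mem_smul_pointwise_iff_exists]
  simp

theorem EZ.quot_list (rs : List A) {c : ℕ} : ∀ {M : Type} [AddCommGroup M] [Module A M],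
    IsWeaklyRegular M rs → (∀ i, c < i → EZ A M N i) → ∀ i, c + rs.length < i →
    EZ A (M ⧸ Ideal.ofList rs • (⊤ : Submodule A M)) N i := by
  induction rs generalizing c with
  | nil =>
    intro M _ _ _ h i hi
    refine EZ.congr_left (Submodule.quotEquivOfEqBot _ (by simp)).symm (h i (by simpa using hi))
  | cons x rs ih =>
    intro M _ _ hreg h i hi
    rw [isWeaklyRegular_cons_iff] at hreg
    have := ih (c := c+1) (M := QuotSMulTop x M) hreg.2 (by
      intro j hj
      obtain ⟨j, rfl⟩ : ∃ k, j = k + 1 := ⟨j-1, by omega⟩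
      obtain ⟨a, b, c⟩ := smulExact hreg.1
      exact EZ.con3 a b c (h j (by omega)) (h (j+1) (by omega))) i (by simp at hi; omega)
    exact EZ.congr_left (Submodule.quotOfListConsSMulTopEquivQuotSMulTopInner M x rs).symm this

theorem reg_quot_prime (p : Ideal A) [hp : p.IsPrime] {x : A} (hx : x ∉ p) : IsSMulRegular (A ⧸ p) x := by
  rw [isSMulRegular_iff_right_eq_zero_of_smul]
  intro y hy
  obtain ⟨y, rfl⟩ := Ideal.Quotient.mk_surjective y
  rw [Ideal.Quotient.eq_zero_iff_mem]
  have : Ideal.Quotient.mk p (x * y) = 0 := hy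
  rw [Ideal.Quotient.eq_zero_iff_mem] at this
  exact (hp.mem_or_mem this).resolve_left hx

theorem exists_inj_of_not_ez (h : ¬ EZ A (A ⧸ maximalIdeal A) M 0) :
    ∃ f : (A ⧸ maximalIdeal A) →ₗ[A] M, Function.Injective f := by
  rw [EZ.zero_iff] at h
  have : IsSimpleModule A (A ⧸ maximalIdeal A) :=
    isSimpleModule_iff_isCoatom.2 (maximalIdeal.isMaximal A).1
  by_contra hc
  push Not at hc
  exact h (subsingleton_of_forall_eq 0 fun f =>
    (LinearMap.injective_or_eq_zero f).resolve_left (hc f))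

theorem ID.step {s : ℕ} (h : ID A (s+1)) (hd : ¬ DepthGE A A (s+1)) : ID A s := by
  -- maximal depth
  have hk : EZ A (A ⧸ maximalIdeal A) A (s+1) := by
    classical
    have h0 : DepthGE A A 0 := ⟨[], rfl, by simp, .nil _ _⟩
    obtain ⟨r, hr, hr1, hrs⟩ : ∃ r, DepthGE A A r ∧ ¬ DepthGE A A (r+1) ∧ r ≤ s := by
      by_contra hc
      push Not at hc
      have : ∀ r, r ≤ s + 1 → DepthGE A A r := by
        intro r
        induction r with
        | zero => exact fun _ => h0
        | succ r ih =>
          intro hr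
          by_contra h3
          have := hc r (ih (by omega)) h3
          omega
      exact hd (this _ le_rfl)
    obtain ⟨xs, rfl, hmem, hreg⟩ := hr
    have h1 : EZ A (A ⧸ Ideal.ofList xs • (⊤ : Submodule A A)) A (s+1) :=
      EZ.quot_list xs (c := 0) hreg (fun i hi => by
        obtain ⟨j, rfl⟩ : ∃ k, i = k + 1 := ⟨i-1, by omega⟩
        exact EZ.proj j) _ (by omega)
    have h2 : ¬ EZ A (A ⧸ maximalIdeal A) (A ⧸ Ideal.ofList xs • (⊤ : Submodule A A)) 0 := by
      intro h2
      obtain ⟨ys, hy, hy1, hy2⟩ := (dg_iff (M := (A ⧸ Ideal.ofList xs • (⊤ : Submodule A A))) 1).2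
        (by intro i hi; obtain rfl : i = 0 := by omega
            exact h2)
      refine hr1 ⟨xs ++ ys, by simp [hy], ?_, (isWeaklyRegular_append_iff _ _ _).2 ⟨hreg, hy2⟩⟩
      intro x hx
      rcases List.mem_append.1 hx with hx | hx
      · exact hmem x hx
      · exact hy1 x hx
    obtain ⟨f, hf⟩ := exists_inj_of_not_ez h2
    exact EZ.con1 hf (g := (LinearMap.range f).mkQ) (LinearMap.exact_map_mkQ_range f)
      (Submodule.mkQ_surjective _) h1 (h _ _ (by omega))
  intro M _ _ hM i hi
  rcases (show s + 1 < i ∨ i = s + 1 by omega) with hi | rfl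
  · exact h M i hi
  refine IsNoetherianRing.induction_on_isQuotientEquivQuotientPrime A hM
    (motive := fun N _ _ _ => EZ A N A (s+1)) ?_ ?_ ?_
  · intro N _ _ _ _; exact EZ.of_subsingleton_left _
  · intro N _ _ _ p e
    refine EZ.congr_left e.symm ?_
    by_cases hp : p.asIdeal = maximalIdeal A
    · rw [hp]; exact hk
    · obtain ⟨x, hx, hxp⟩ := SetLike.exists_of_lt
        (lt_of_le_of_ne (le_maximalIdeal p.isPrime.ne_top) hp)
      exact EZ.nakayama hx (reg_quot_prime p.asIdeal hxp) (h _ _ (by omega))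
  · intro N₁ _ _ _ N₂ _ _ _ N₃ _ _ _ f g hf hg hfg h1 h2
    exact EZ.con2 hf hfg hg h1 h2

theorem ID.bass {n t : ℕ} (h : ID A n) (hd : ¬ DepthGE A A (t+1)) : ID A t := by
  induction n with
  | zero => intro M _ _ _ i hi; exact h M i (by omega)
  | succ n ih =>
    by_cases hn : n < t
    · intro M _ _ _ i hi; exact h M i (by omega)
    · exact ih (h.step fun hc => hd (dg_mono (by omega) hc))

theorem ID.dim {n t : ℕ} (h : ID A n) (ht : DepthGE A A t) (hd : ¬ DepthGE A A (t+1)) :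
    ringKrullDim A = t := by
  have hb := h.bass hd
  obtain ⟨xs, rfl, hmem, hreg⟩ := ht
  have hreg' := IsRegular.of_isWeaklyRegular_of_mem_maximalIdeal A hmem hreg
  have hle : Ideal.ofList xs ≤ maximalIdeal A := Ideal.span_le.2 hmem
  have key : ∀ p : Ideal A, p.IsPrime → Ideal.ofList xs ≤ p → p = maximalIdeal A := by
    intro p hp hxp
    by_contra hpm
    have hpm' := le_maximalIdeal hp.ne_top
    obtain ⟨y, hy, hyp⟩ := SetLike.exists_of_lt (lt_of_le_of_ne hpm' hpm)
    have h1 : EZ A (A ⧸ p) A xs.length :=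
      EZ.nakayama hy (reg_quot_prime p hyp) (hb _ _ (by omega))
    have h2 := ModuleCat.subsingleton_ext_of_exists_isRegular p
      (ModuleCat.of A (A ⧸ p)) (supp_quot _).le (ModuleCat.of A A)
      (smul_lt (M := A) _ hpm') xs (fun r hr => hxp (Ideal.subset_span hr)) hreg'
    obtain ⟨rs, h3, h4, h5⟩ := ModuleCat.exists_isRegular_of_exists_subsingleton_ext p
      (xs.length+1) (ModuleCat.of A A) (smul_lt (M := A) _ hpm') (ModuleCat.of A (A ⧸ p)) (supp_quot _)
      (fun i hi => by
        rcases (show i < xs.length ∨ i = xs.length by omega) with hi | rfl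
        · exact h2 i hi
        · exact h1)
    exact hd ⟨rs, h3, fun r hr => hpm' (h4 r hr), h5.1⟩
  rw [← ringKrullDim_add_length_eq_ringKrullDim_of_isRegular xs hreg']
  have hlt : Ideal.ofList xs ≠ ⊤ := fun hc => (maximalIdeal.isMaximal A).ne_top (top_le_iff.1 (hc ▸ hle))
  have : Nontrivial (A ⧸ Ideal.ofList xs) := Ideal.Quotient.nontrivial_iff.2 hlt
  have : Ring.KrullDimLE 0 (A ⧸ Ideal.ofList xs) := by
    rw [Ring.krullDimLE_zero_iff]
    intro q hq
    have := key (q.comap (Ideal.Quotient.mk _)) (hq.comap _) (by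
      intro x hx
      rw [Ideal.mem_comap, Ideal.Quotient.eq_zero_iff_mem.2 hx]; exact zero_mem _)
    have hm : (q.comap (Ideal.Quotient.mk (Ideal.ofList xs))).IsMaximal := this ▸ maximalIdeal.isMaximal A
    have h := (Ideal.map_eq_top_or_isMaximal_of_surjective (Ideal.Quotient.mk (Ideal.ofList xs))
      Ideal.Quotient.mk_surjective hm)
    rw [Ideal.map_comap_of_surjective _ Ideal.Quotient.mk_surjective] at h
    exact h.resolve_left hq.ne_top
  have h0 : ringKrullDim (A ⧸ Ideal.ofList xs) = 0 := by
    refine le_antisymm ?_ ringKrullDim_nonneg_of_nontrivial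
    exact_mod_cast (Order.krullDimLE_iff 0 _).1 this
  rw [h0, zero_add]

theorem dg_le_dim {t : ℕ} (ht : DepthGE A A t) : (t : WithBot ℕ∞) ≤ ringKrullDim A := by
  obtain ⟨xs, rfl, hmem, hreg⟩ := ht
  have hreg' := IsRegular.of_isWeaklyRegular_of_mem_maximalIdeal A hmem hreg
  have hle : Ideal.ofList xs ≤ maximalIdeal A := Ideal.span_le.2 hmem
  have hlt : Ideal.ofList xs ≠ ⊤ := fun hc => (maximalIdeal.isMaximal A).ne_top (top_le_iff.1 (hc ▸ hle))
  have : Nontrivial (A ⧸ Ideal.ofList xs) := Ideal.Quotient.nontrivial_iff.2 hlt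
  rw [← ringKrullDim_add_length_eq_ringKrullDim_of_isRegular xs hreg']
  exact le_add_of_nonneg_left ringKrullDim_nonneg_of_nontrivial

theorem ID.depth_eq {n d : ℕ} (h : ID A n) (hd : ringKrullDim A = d) :
    DepthGE A A d ∧ ¬ DepthGE A A (d+1) ∧ ID A d := by
  have h1 : ¬ DepthGE A A (d+1) := fun hc => by
    have := dg_le_dim hc
    rw [hd] at this
    have : d + 1 ≤ d := by exact_mod_cast this
    omega
  have h0 : DepthGE A A 0 := ⟨[], rfl, by simp, .nil _ _⟩
  refine ⟨?_, h1, h.bass h1⟩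
  by_contra hc
  have : ∀ t, DepthGE A A t := by
    intro t
    induction t with
    | zero => exact h0
    | succ t ih =>
      by_contra h3
      have := h.dim ih h3
      rw [hd] at this
      have : d = t := by exact_mod_cast this
      exact hc (this ▸ ih)
  exact hc (this d)

theorem EZ.of_dg {t : ℕ} (h : ID A t) (rs : List A) : ∀ (M : Type) [AddCommGroup M] [Module A M]
    [Module.Finite A M], (∀ x ∈ rs, x ∈ maximalIdeal A) → IsWeaklyRegular M rs →
    ∀ i, t < i + rs.length → EZ A M A i := by
  induction rs with
  | nil => intro M _ _ _ _ _ i hi; exact h M i (by simpa using hi)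
  | cons x rs ih =>
    intro M _ _ _ hm hr i hi
    rw [isWeaklyRegular_cons_iff] at hr
    refine EZ.nakayama (hm x (by simp)) hr.1 (ih _ (fun y hy => hm y (by simp [hy])) hr.2 _ ?_)
    simp at hi; omega

theorem EZ.of_dg' {t : ℕ} (h : ID A t) [Module.Finite A M] (hM : DepthGE A M t) {i : ℕ} (hi : 0 < i) :
    EZ A M A i := by
  obtain ⟨rs, rfl, h2, h3⟩ := hM
  exact EZ.of_dg h rs M h2 h3 i (by omega)

end Depth
end Hlp

namespace Hlp
section Dual
open RingTheory.Sequence IsLocalRing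
open Module
set_option linter.unusedSectionVars false
variable {A : Type} [CommRing A]
  {K P M N : Type} [AddCommGroup M] [Module A M] [AddCommGroup N] [Module A N]
  [AddCommGroup K] [Module A K] [AddCommGroup P] [Module A P]

theorem surj_eval [Module.Finite A P] [Module.Projective A P] (π : P →ₗ[A] N)
    (h : ∀ ξ : Dual A N →ₗ[A] A, ∃ ξ' : Dual A P →ₗ[A] A, ξ'.comp π.dualMap = ξ) :
    Function.Surjective (Dual.eval A N) := by
  intro ξ
  obtain ⟨ξ', rfl⟩ := h ξ
  obtain ⟨f, rfl⟩ := (Module.bijective_dual_eval A P).2 ξ'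
  exact ⟨π f, by ext φ; rfl⟩

theorem inj_eval [Module.Finite A P] [Module.Projective A P] {i : K →ₗ[A] P} {π : P →ₗ[A] N}
    (hex : Function.Exact i π) (hπ : Function.Surjective π)
    (hi : ∀ φ : K →ₗ[A] A, ∃ ψ : P →ₗ[A] A, ψ.comp i = φ)
    (hK : Function.Surjective (Dual.eval A K)) :
    Function.Injective (Dual.eval A N) := by
  rw [injective_iff_map_eq_zero]
  intro x hx
  obtain ⟨f, rfl⟩ := hπ x
  have hs : Function.Surjective i.dualMap := fun φ => by
    obtain ⟨ψ, hψ⟩ := hi φ; exact ⟨ψ, hψ⟩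
  have hle : LinearMap.ker i.dualMap ≤ LinearMap.ker (Dual.eval A P f) := by
    intro ψ hψ
    have hψ' : ψ.comp i = 0 := hψ
    have hk : LinearMap.ker π ≤ LinearMap.ker ψ := by
      intro y hy
      obtain ⟨z, rfl⟩ := (hex y).1 hy
      exact LinearMap.congr_fun hψ' z
    let φ : Dual A N := ((LinearMap.ker π).liftQ ψ hk).comp (π.quotKerEquivOfSurjective hπ).symm.toLinearMap
    have h1 : φ (π f) = ψ f := by
      have : (π.quotKerEquivOfSurjective hπ).symm (π f) = Submodule.Quotient.mk f := by
        rw [LinearEquiv.symm_apply_eq]; rfl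
      simp [φ, this]
    have h2 : φ (π f) = 0 := LinearMap.congr_fun hx φ
    show ψ f = 0
    rw [← h1, h2]
  let η : Dual A K →ₗ[A] A := ((LinearMap.ker i.dualMap).liftQ (Dual.eval A P f) hle).comp
    (i.dualMap.quotKerEquivOfSurjective hs).symm.toLinearMap
  have hη : ∀ ψ : Dual A P, η (i.dualMap ψ) = ψ f := by
    intro ψ
    have : (i.dualMap.quotKerEquivOfSurjective hs).symm (i.dualMap ψ) = Submodule.Quotient.mk ψ := by
      rw [LinearEquiv.symm_apply_eq]; rfl
    simp only [η, LinearMap.comp_apply, LinearEquiv.coe_coe, this]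
    rfl
  obtain ⟨k, hk⟩ := hK η
  have : f = i k := by
    apply (Module.bijective_dual_eval A P).1
    ext ψ
    show ψ f = ψ (i k)
    rw [← hη, ← hk]; rfl
  rw [this]
  exact (hex _).2 ⟨k, rfl⟩

theorem isSyz_of_exact {K P M : Type} [AddCommGroup M] [Module A M] 
  [AddCommGroup K] [Module A K] [AddCommGroup P] [Module A P] [Module.Finite A P] [Module.Projective A P]
   {f : M →ₗ[A] P} {g : P →ₗ[A] K} (hf : Function.Injective f) (hfg : Function.Exact f g)
   (hg : Function.Surjective g) : IsSyzygy A (ModuleCat.of A M) (ModuleCat.of A K) := by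
  refine ⟨ModuleCat.of A P, g, ⟨inferInstance, inferInstance⟩, hg, ⟨?_⟩⟩
  refine (LinearEquiv.ofInjective f hf).trans (LinearEquiv.ofEq _ _ ?_)
  exact (LinearMap.exact_iff.1 hfg).symm

theorem EZ.syz_up {M N : ModuleCat.{0} A} {n : ℕ} (h : IsNthSyzygy A n M N) {Y : Type} [AddCommGroup Y]
    [Module A Y] {i : ℕ} (hi : EZ A N Y (i+1+n)) : EZ A M Y (i+1) := by
  induction n generalizing M i with
  | zero => obtain ⟨e⟩ := h; exact EZ.congr_left e.symm hi
  | succ n ih =>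
    obtain ⟨K, hK, P, f, ⟨_, _⟩, hf, ⟨e⟩⟩ := h
    have := ih hK (i := i+1) (by convert hi using 1; omega)
    refine EZ.congr_left e.symm ?_
    exact EZ.con1 (LinearMap.ker f).subtype_injective (LinearMap.exact_subtype_ker_map f) hf
      (EZ.proj _) this

theorem EZ.syz_down {M N : ModuleCat.{0} A} {n : ℕ} (h : IsNthSyzygy A n M N) {Y : Type} [AddCommGroup Y]
    [Module A Y] {i : ℕ} (hi : EZ A M Y (i+1)) : EZ A N Y (i+1+n) := by
  induction n generalizing M i with
  | zero => obtain ⟨e⟩ := h; exact EZ.congr_left e hi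
  | succ n ih =>
    obtain ⟨K, hK, P, f, ⟨_, _⟩, hf, ⟨e⟩⟩ := h
    have := EZ.con3 (LinearMap.ker f).subtype_injective (LinearMap.exact_subtype_ker_map f) hf
      (EZ.congr_left e hi) (EZ.proj _)
    convert ih hK this using 1; omega

theorem exists_syz [IsNoetherianRing A] (n : ℕ) (N : ModuleCat.{0} A) [Module.Finite A N] :
    ∃ M : ModuleCat.{0} A, Module.Finite A M ∧ IsNthSyzygy A n M N := by
  induction n with
  | zero => exact ⟨N, inferInstance, ⟨LinearEquiv.refl _ _⟩⟩
  | succ n ih =>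
    obtain ⟨K, hK, h⟩ := ih
    obtain ⟨k, f, hf⟩ := Module.Finite.exists_fin' A K
    exact ⟨ModuleCat.of A (LinearMap.ker f), inferInstanceAs (Module.Finite A (LinearMap.ker f)), K, h,
      ModuleCat.of A (Fin k → A), f, ⟨inferInstanceAs (Module.Finite A (Fin k → A)),
        inferInstanceAs (Module.Projective A (Fin k → A))⟩, hf, ⟨LinearEquiv.refl _ _⟩⟩

/-- being an `n`-th syzygy module -/
def Syzn (A : Type) [CommRing A] (n : ℕ) (M : Type) [AddCommGroup M] [Module A M] : Prop :=
  ∃ N : ModuleCat.{0} A, Module.Finite A N ∧ IsNthSyzygy A n (ModuleCat.of A M) N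

theorem Syzn.succ [Module.Finite A P] [Module.Projective A P]
   {f : M →ₗ[A] P} {g : P →ₗ[A] K} (hf : Function.Injective f) (hfg : Function.Exact f g)
   (hg : Function.Surjective g) {n : ℕ} (h : Syzn A n K) : Syzn A (n+1) M := by
  obtain ⟨N, hN, h⟩ := h
  exact ⟨N, hN, _, h, isSyz_of_exact hf hfg hg⟩

theorem Syzn.congr (e : M ≃ₗ[A] N) {n : ℕ} (h : Syzn A n M) : Syzn A n N := by
  obtain ⟨X, hX, h⟩ := h
  refine ⟨X, hX, ?_⟩
  cases n with
  | zero => obtain ⟨e'⟩ := h; exact ⟨e.symm.trans e'⟩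
  | succ n =>
    obtain ⟨K, hK, P, f, hP, hf, ⟨e'⟩⟩ := h
    exact ⟨K, hK, P, f, hP, hf, ⟨e.symm.trans e'⟩⟩

theorem Syzn.ez {t : ℕ} (h : ID A t) (hM : Syzn A t M) (i : ℕ) : EZ A M A (i+1) := by
  obtain ⟨N, hN, h'⟩ := hM
  exact EZ.syz_up (M := ModuleCat.of A M) h' (h N _ (by omega))

theorem dual_exact {f : K →ₗ[A] P} {g : P →ₗ[A] N} (hfg : Function.Exact f g)
    (hg : Function.Surjective g) : Function.Injective g.dualMap ∧ Function.Exact g.dualMap f.dualMap :=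
  ⟨LinearMap.dualMap_injective_of_surjective hg, fun ψ => by
    constructor
    · intro hψ
      have hk : LinearMap.ker g ≤ LinearMap.ker ψ := by
        intro y hy
        obtain ⟨z, rfl⟩ := (hfg y).1 hy
        exact LinearMap.congr_fun (show ψ.comp f = 0 from hψ) z
      refine ⟨((LinearMap.ker g).liftQ ψ hk).comp (g.quotKerEquivOfSurjective hg).symm.toLinearMap, ?_⟩
      ext y
      have : (g.quotKerEquivOfSurjective hg).symm (g y) = Submodule.Quotient.mk y := by
        rw [LinearEquiv.symm_apply_eq]; rfl
      simp [this]
    · rintro ⟨φ, rfl⟩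
      ext z
      show φ (g (f z)) = 0
      rw [(hfg _).2 ⟨z, rfl⟩, map_zero]⟩

theorem lemD [IsNoetherianRing A] (n : ℕ) : ∀ (L : Type) [AddCommGroup L] [Module A L] [Module.Finite A L],
    (∀ i, EZ A L A (i+1)) → Syzn A n (Dual A L) := by
  induction n with
  | zero => 
    intro L _ _ _ h
    exact ⟨ModuleCat.of A (Dual A L), inferInstanceAs (Module.Finite A (Dual A L)), ⟨LinearEquiv.refl _ _⟩⟩
  | succ n ih =>
    intro L _ _ _ h
    obtain ⟨k, f, hf⟩ := Module.Finite.exists_fin' A L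
    have hex := LinearMap.exact_subtype_ker_map f
    have hi := (LinearMap.ker f).subtype_injective
    obtain ⟨h1, h2⟩ := dual_exact hex hf
    exact Syzn.succ h1 h2 (fun φ => EZ.extend hi hex hf (h 0) φ)
      (ih (LinearMap.ker f) (fun i => EZ.con1 hi hex hf (EZ.proj i) (h (i+1))))

theorem lemT_surj [IsNoetherianRing A] {t : ℕ} (hA : ID A t) [Module.Finite A N]
    (h : ∀ i, EZ A N A (i+1)) : Function.Surjective (Dual.eval A N) := by
  obtain ⟨k, f, hf⟩ := Module.Finite.exists_fin' A N
  have hex := LinearMap.exact_subtype_ker_map f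
  have hi := (LinearMap.ker f).subtype_injective
  have hK : ∀ i, EZ A (LinearMap.ker f) A (i+1) := fun i => EZ.con1 hi hex hf (EZ.proj i) (h (i+1))
  obtain ⟨h1, h2⟩ := dual_exact hex hf
  refine surj_eval f fun ξ => EZ.extend h1 h2 (fun φ => EZ.extend hi hex hf (h 0) φ) ?_ ξ
  exact (lemD t _ hK).ez hA 0

theorem lemT_inj [IsNoetherianRing A] {t : ℕ} (hA : ID A t) [Module.Finite A N]
    (h : ∀ i, EZ A N A (i+1)) : Function.Injective (Dual.eval A N) := by
  obtain ⟨k, f, hf⟩ := Module.Finite.exists_fin' A N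
  have hex := LinearMap.exact_subtype_ker_map f
  have hi := (LinearMap.ker f).subtype_injective
  have hK : ∀ i, EZ A (LinearMap.ker f) A (i+1) := fun i => EZ.con1 hi hex hf (EZ.proj i) (h (i+1))
  exact inj_eval hex hf (fun φ => EZ.extend hi hex hf (h 0) φ) (lemT_surj hA hK)

theorem exists_approx [IsNoetherianRing A] (M : Type) [AddCommGroup M] [Module A M] [Module.Finite A M] :
    ∃ (k : ℕ) (f : M →ₗ[A] (Fin k → A)), ∀ φ : M →ₗ[A] A, ∃ ψ : (Fin k → A) →ₗ[A] A, ψ.comp f = φ := by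
  obtain ⟨k, g, hg⟩ := Module.Finite.exists_fin' A (Dual A M)
  refine ⟨k, LinearMap.pi fun i => g (Pi.single i 1), fun φ => ?_⟩
  obtain ⟨c, rfl⟩ := hg φ
  refine ⟨∑ i, c i • LinearMap.proj i, ?_⟩
  ext x
  conv_rhs => rw [LinearMap.pi_apply_eq_sum_univ g c]
  have : ∀ i : Fin k, (fun j => if i = j then (1 : A) else 0) = Pi.single i 1 := by
    intro i; ext j; simp [Pi.single_apply, eq_comm]
  simp [this]

theorem approx_inj {f : M →ₗ[A] P} (hM : Function.Injective (Dual.eval A M))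
    (hf : ∀ φ : M →ₗ[A] A, ∃ ψ : P →ₗ[A] A, ψ.comp f = φ) : Function.Injective f := by
  rw [injective_iff_map_eq_zero]
  intro x hx
  apply hM
  ext φ
  obtain ⟨ψ, rfl⟩ := hf φ
  simp [hx]

theorem approx_proj {f : M →ₗ[A] P} 
    (hf : ∀ φ : M →ₗ[A] A, ∃ ψ : P →ₗ[A] A, ψ.comp f = φ) {Q : Type} [AddCommGroup Q] [Module A Q]
    [Module.Finite A Q] [Module.Projective A Q] (g : M →ₗ[A] Q) : ∃ h : P →ₗ[A] Q, h.comp f = g := by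
  obtain ⟨k, u, hu⟩ := Module.Finite.exists_fin' A Q
  obtain ⟨s, hs⟩ := Module.projective_lifting_property u LinearMap.id hu
  choose ψ hψ using fun j : Fin k => hf ((LinearMap.proj j).comp (s.comp g))
  refine ⟨u.comp (LinearMap.pi ψ), ?_⟩
  have : (LinearMap.pi ψ).comp f = s.comp g := by
    ext x j
    exact LinearMap.congr_fun (hψ j) x
  rw [LinearMap.comp_assoc, this, ← LinearMap.comp_assoc, hs, LinearMap.id_comp]

/-- the main coresolution step -/
theorem exists_cosyz [IsNoetherianRing A] {t : ℕ} (hA : ID A t) [Module.Finite A N]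
    (h : ∀ i, EZ A N A (i+1)) : ∃ (k : ℕ) (f : N →ₗ[A] (Fin k → A)), Function.Injective f ∧
      ∀ i, EZ A ((Fin k → A) ⧸ LinearMap.range f) A (i+1) := by
  obtain ⟨k, f, hf⟩ := exists_approx (A := A) N
  have hi := approx_inj (lemT_inj hA h) hf
  refine ⟨k, f, hi, fun i => ?_⟩
  cases i with
  | zero => exact EZ.one_of_extend hi (LinearMap.exact_map_mkQ_range f) (Submodule.mkQ_surjective _) (EZ.proj 0) hf
  | succ i => exact EZ.con3 hi (LinearMap.exact_map_mkQ_range f) (Submodule.mkQ_surjective _) (h i) (EZ.proj _)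

theorem dg_of_ez [IsNoetherianRing A] [IsLocalRing A] {t c : ℕ} (hA : ID A t) (hc : DepthGE A A c)
    [Module.Finite A N] (h : ∀ i, EZ A N A (i+1)) : DepthGE A N c := by
  rw [dg_iff] at hc ⊢
  intro i
  induction i generalizing N with
  | zero =>
    intro hi
    obtain ⟨k, f, hf, -⟩ := exists_cosyz hA h
    have := EZ.zero_iff.1 (EZ.fin _ (hc 0 hi) k)
    rw [EZ.zero_iff]
    refine ⟨fun a b => ?_⟩
    have hab : f.comp a = f.comp b := Subsingleton.elim _ _
    ext
    exact hf (LinearMap.congr_fun hab (Ideal.Quotient.mk _ 1))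
  | succ i ih =>
    intro hi
    obtain ⟨k, f, hf, hC⟩ := exists_cosyz hA h
    exact EZ.cov1 hf (LinearMap.exact_map_mkQ_range f) (Submodule.mkQ_surjective _)
      (EZ.fin _ (hc _ hi) k) (ih hC (by omega))

end Dual
end Hlp

namespace Hlp
section Gor
open IsLocalRing
open Module
set_option linter.unusedSectionVars false

theorem gor_injdim {R : Type} [CommRing R] (h : Gorenstein R) :
    ∃ n, HasInjectiveDimensionLE (ModuleCat.of R R) n := by
  obtain ⟨n, hn⟩ := h
  refine ⟨n, HasInjectiveDimensionLT.mk fun i hi Y e => ?_⟩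
  obtain ⟨j, rfl⟩ : ∃ j, i = j + 1 := ⟨i-1, by omega⟩
  have := (extVanish_iff R Y (ModuleCat.of R R) j).1 (hn (j+1) (by omega) Y)
  exact @Subsingleton.elim _ this _ _

theorem id_of_injdim {R : Type} [CommRing R] {n : ℕ} (h : HasInjectiveDimensionLE (ModuleCat.of R R) n) :
    ID R n := by
  intro M _ _ _ i hi
  exact HasInjectiveDimensionLT.subsingleton (ModuleCat.of R R) (n+1) i (by omega) (ModuleCat.of R M)

/-- localization of the ring as a module -/
def locE (R : Type) [CommRing R] (S : Submonoid R) : LocalizedModule S R ≃ₗ[Localization S] Localization S :=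
  (IsLocalizedModule.linearEquiv S (LocalizedModule.mkLinearMap S R)
    (Algebra.linearMap R (Localization S))).extendScalarsOfIsLocalization S (Localization S)

theorem id_loc {R : Type} [CommRing R] [IsNoetherianRing R] (h : Gorenstein R) (S : Submonoid R) :
    ∃ n, ID (Localization S) n := by
  obtain ⟨n, hn⟩ := gor_injdim h
  refine ⟨n, id_of_injdim ?_⟩
  have h1 := ModuleCat.localizedModule_hasInjectiveDimensionLE n S (ModuleCat.of R R)
  refine (ModuleCat.hasInjectiveDimensionLE_iff_of_linearEquiv ?_ n).1 h1
  exact (Shrink.linearEquiv (Localization S) (LocalizedModule S R)).trans (locE R S)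

end Gor

section Loc
open IsLocalRing
open Module
set_option linter.unusedSectionVars false
variable {R : Type} [CommRing R] (S : Submonoid R)
  {L M N : Type} [AddCommGroup L] [Module R L] [AddCommGroup M] [Module R M] [AddCommGroup N] [Module R N]

theorem loc_exact {f : L →ₗ[R] M} {g : M →ₗ[R] N} (hf : Function.Injective f)
    (hfg : Function.Exact f g) (hg : Function.Surjective g) :
    Function.Injective (LocalizedModule.map S f) ∧
    Function.Exact (LocalizedModule.map S f) (LocalizedModule.map S g) ∧
    Function.Surjective (LocalizedModule.map S g) :=
  ⟨LocalizedModule.map_injective S f hf, LocalizedModule.map_exact S f g hfg,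
    LocalizedModule.map_surjective S g hg⟩

theorem loc_hom [IsNoetherianRing R] [Module.Finite R M]
    (φ : LocalizedModule S M →ₗ[Localization S] Localization S) :
    ∃ (g : M →ₗ[R] R) (a : Localization S), 
      φ = a • (locE R S).toLinearMap.comp (LocalizedModule.map S g) := by
  have : Module.FinitePresentation R M := Module.finitePresentation_of_finite R M
  obtain ⟨⟨g, s⟩, hs⟩ := IsLocalizedModule.surj S (LocalizedModule.map S (M := M) (N := R))
    ((locE R S).symm.toLinearMap.comp φ)
  refine ⟨g, Localization.mk 1 s, ?_⟩
  rw [← hs]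
  ext x
  have h1 : (Localization.mk 1 s : Localization S) * algebraMap R _ (s : R) = 1 := by
    rw [← Localization.mk_one_eq_algebraMap, Localization.mk_mul, one_mul, mul_one, Localization.mk_self]
  have h2 : (s • (locE R S).symm.toLinearMap.comp φ) x = algebraMap R (Localization S) (s : R) • ((locE R S).symm (φ x)) := by
    rw [algebraMap_smul]; rfl
  simp only [LinearMap.smul_apply, LinearMap.comp_apply, LinearEquiv.coe_coe, h2]
  rw [LinearEquiv.map_smul, LinearEquiv.apply_symm_apply, smul_smul, h1, one_smul]

end Loc

section Dg
open IsLocalRing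
variable {A : Type} [CommRing A] [IsNoetherianRing A] [IsLocalRing A]
  {L M N : Type} [AddCommGroup L] [Module A L] [AddCommGroup M] [Module A M] [AddCommGroup N] [Module A N]
  [Module.Finite A L] [Module.Finite A M] [Module.Finite A N]

theorem dg_zero {A : Type} [CommRing A] [IsLocalRing A] {M : Type} [AddCommGroup M] [Module A M] :
    DepthGE A M 0 := ⟨[], rfl, by simp, .nil _ _⟩

theorem dg_left {f : L →ₗ[A] M} {g : M →ₗ[A] N} (hf : Function.Injective f)
    (hfg : Function.Exact f g) (hg : Function.Surjective g) {c : ℕ} (h1 : DepthGE A M (c+1))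
    (h2 : DepthGE A N c) : DepthGE A L (c+1) := by
  rw [dg_iff] at *
  intro i hi
  cases i with
  | zero =>
    have := EZ.zero_iff.1 (h1 0 hi)
    rw [EZ.zero_iff]
    refine ⟨fun a b => ?_⟩
    have hab : f.comp a = f.comp b := Subsingleton.elim _ _
    ext
    exact hf (LinearMap.congr_fun hab (Ideal.Quotient.mk _ 1))
  | succ i => exact EZ.cov1 hf hfg hg (h1 _ hi) (h2 _ (by omega))

theorem dg_mid {f : L →ₗ[A] M} {g : M →ₗ[A] N} (hf : Function.Injective f)
    (hfg : Function.Exact f g) (hg : Function.Surjective g) {c : ℕ} (h1 : DepthGE A L c)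
    (h2 : DepthGE A N c) : DepthGE A M c := by
  rw [dg_iff] at *
  exact fun i hi => EZ.cov2 hf hfg hg (h1 i hi) (h2 i hi)

theorem dg_right {f : L →ₗ[A] M} {g : M →ₗ[A] N} (hf : Function.Injective f)
    (hfg : Function.Exact f g) (hg : Function.Surjective g) {c : ℕ} (h1 : DepthGE A M c)
    (h2 : DepthGE A L (c+1)) : DepthGE A N c := by
  rw [dg_iff] at *
  exact fun i hi => EZ.cov3 hf hfg hg (h1 i hi) (h2 (i+1) (by omega))

theorem dg_proj [Module.Projective A M] {c : ℕ} (h : DepthGE A A c) : DepthGE A M c := by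
  have : Module.Free A M := Module.free_of_flat_of_isLocalRing
  exact dg_free h

end Dg

section Serre
open IsLocalRing
open Module
set_option linter.unusedSectionVars false
variable {R : Type} [CommRing R] [IsNoetherianRing R]
  {L M N : Type} [AddCommGroup L] [Module R L] [AddCommGroup M] [Module R M] [AddCommGroup N] [Module R N]

theorem serre_proj (n : ℕ) [Module.Finite R M] [Module.Projective R M] : SerreS R n (ModuleCat.of R M) := by
  intro p c hc h
  exact dg_proj h

theorem serre_left [Module.Finite R L] [Module.Finite R M] [Module.Finite R N] 
    {f : L →ₗ[R] M} {g : M →ₗ[R] N} (hf : Function.Injective f)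
    (hfg : Function.Exact f g) (hg : Function.Surjective g) {n : ℕ} (h1 : SerreS R (n+1) (ModuleCat.of R M))
    (h2 : SerreS R n (ModuleCat.of R N)) : SerreS R (n+1) (ModuleCat.of R L) := by
  intro p c hc h
  cases c with
  | zero => exact dg_zero
  | succ c =>
    obtain ⟨a, b, d⟩ := loc_exact p.asIdeal.primeCompl hf hfg hg
    exact dg_left a b d (h1 p _ hc h) (h2 p c (by omega) (dg_mono (by omega) h))

theorem serre_mid [Module.Finite R L] [Module.Finite R M] [Module.Finite R N] 
    {f : L →ₗ[R] M} {g : M →ₗ[R] N} (hf : Function.Injective f)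
    (hfg : Function.Exact f g) (hg : Function.Surjective g) {n : ℕ} (h1 : SerreS R n (ModuleCat.of R L))
    (h2 : SerreS R n (ModuleCat.of R N)) : SerreS R n (ModuleCat.of R M) := by
  intro p c hc h
  obtain ⟨a, b, d⟩ := loc_exact p.asIdeal.primeCompl hf hfg hg
  exact dg_mid a b d (h1 p _ hc h) (h2 p c hc h)

theorem serre_mono {n m : ℕ} (h : m ≤ n) {M : ModuleCat.{0} R} (hM : SerreS R n M) : SerreS R m M :=
  fun p c hc => hM p c (hc.trans h)

theorem serre_congr (e : M ≃ₗ[R] N) [Module.Finite R M] {n : ℕ} (h : SerreS R n (ModuleCat.of R M)) :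
    SerreS R n (ModuleCat.of R N) := by
  have : Module.Finite R N := Module.Finite.equiv e
  exact serre_mid (L := M) (M := N) (N := PUnit) (f := e.toLinearMap) (g := 0) e.injective
    (by intro x; simp) (fun x => ⟨0, rfl⟩) h (serre_proj n)

theorem syz_finite {n : ℕ} (M N : ModuleCat.{0} R) (hN : Module.Finite R N) (h : IsNthSyzygy R n M N) :
    Module.Finite R M := by
  cases n with
  | zero => obtain ⟨e⟩ := h; exact Module.Finite.equiv e.symm
  | succ n =>
    obtain ⟨K, hK, P, f, ⟨_, _⟩, hf, ⟨e⟩⟩ := h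
    exact Module.Finite.equiv e.symm

theorem serre_of_syz {n : ℕ} (M N : ModuleCat.{0} R) (hN : Module.Finite R N) (h : IsNthSyzygy R n M N) :
    SerreS R n M := by
  induction n generalizing M with
  | zero => intro p c hc _; obtain rfl : c = 0 := by omega
            exact dg_zero
  | succ n ih =>
    have hM := syz_finite M N hN h
    obtain ⟨K, hK, P, f, ⟨_, _⟩, hf, ⟨e⟩⟩ := h
    have hKf := syz_finite K N hN hK
    refine serre_congr e.symm ?_
    exact serre_left (LinearMap.ker f).subtype_injective (LinearMap.exact_subtype_ker_map f) hf
      (serre_proj _) (ih K hK)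

theorem torsionless (hG : Gorenstein R) [Module.Finite R M] (hM : SerreS R 1 (ModuleCat.of R M)) :
    Function.Injective (Dual.eval R M) := by
  rw [← LinearMap.ker_eq_bot]
  by_contra hne
  have hnt : Nontrivial (LinearMap.ker (Dual.eval R M)) := Submodule.nontrivial_iff_ne_bot.2 hne
  obtain ⟨P, hP⟩ := associatedPrimes.nonempty R (LinearMap.ker (Dual.eval R M))
  obtain ⟨hprime, ⟨y, hyK⟩, hy⟩ := isAssociatedPrime_iff.1 hP
  let p : PrimeSpectrum R := ⟨P, hprime⟩
  have hann : ∀ r : R, r ∈ P ↔ r • y = 0 := by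
    intro r
    rw [hy, Submodule.mem_colon_singleton, Submodule.mem_bot, Subtype.ext_iff]; rfl
  have hk : ∀ φ : M →ₗ[R] R, φ y = 0 := fun φ => LinearMap.congr_fun hyK φ
  let S := p.asIdeal.primeCompl
  have hy0 : (LocalizedModule.mk y 1 : LocalizedModule S M) ≠ 0 := by
    intro h0
    rw [← LocalizedModule.zero_mk 1, LocalizedModule.mk_eq] at h0
    obtain ⟨u, hu⟩ := h0
    simp only [smul_zero, one_smul] at hu
    exact u.2 ((hann u.1).2 hu)
  have hd : ¬ DepthGE (Localization.AtPrime p.asIdeal) (LocalizedModule S M) 1 := by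
    rintro ⟨rs, h1, h2, h3⟩
    obtain ⟨r, rfl⟩ := List.length_eq_one_iff.1 h1
    rw [RingTheory.Sequence.isWeaklyRegular_cons_iff] at h3
    have hr := h2 r (by simp)
    obtain ⟨a, s, rfl⟩ := IsLocalization.exists_mk'_eq S r
    rw [IsLocalization.AtPrime.mk'_mem_maximal_iff _ p.asIdeal] at hr
    apply hy0
    apply h3.1
    show _ • _ = _ • _
    rw [smul_zero, ← Localization.mk_eq_mk', LocalizedModule.mk_smul_mk, (hann a).1 hr, LocalizedModule.zero_mk]
  obtain ⟨t, ht⟩ := id_loc hG S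
  have hA : ¬ DepthGE (Localization.AtPrime p.asIdeal) (Localization.AtPrime p.asIdeal) 1 :=
    fun h => hd (hM p 1 le_rfl h)
  have hb : ID (Localization.AtPrime p.asIdeal) 0 := ht.bass hA
  have hinj := lemT_inj (N := LocalizedModule S M) hb (fun i => hb _ _ (by omega))
  apply hy0
  apply hinj
  rw [map_zero]
  ext φ
  obtain ⟨g, a, rfl⟩ := loc_hom S φ
  simp [LocalizedModule.map_mk, hk]

theorem approx_loc [Module.Finite R M] {k : ℕ} {f : M →ₗ[R] (Fin k → R)}
    (hf : ∀ φ : M →ₗ[R] R, ∃ ψ : (Fin k → R) →ₗ[R] R, ψ.comp f = φ) (S : Submonoid R)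
    (φ : LocalizedModule S M →ₗ[Localization S] Localization S) :
    ∃ ψ : LocalizedModule S (Fin k → R) →ₗ[Localization S] Localization S,
      ψ.comp (LocalizedModule.map S f) = φ := by
  obtain ⟨g, a, rfl⟩ := loc_hom S φ
  obtain ⟨ψ, rfl⟩ := hf g
  refine ⟨a • (locE R S).toLinearMap.comp (LocalizedModule.map S ψ), ?_⟩
  ext x
  induction x using LocalizedModule.induction_on with
  | _ m s => simp [LocalizedModule.map_mk]

theorem syz_of_serre (hG : Gorenstein R) (n : ℕ) : ∀ (M : Type) [AddCommGroup M] [Module R M] [Module.Finite R M],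
    SerreS R n (ModuleCat.of R M) → Syzn R n M := by
  induction n with
  | zero => intro M _ _ _ _; exact ⟨ModuleCat.of R M, inferInstanceAs (Module.Finite R M), ⟨LinearEquiv.refl _ _⟩⟩
  | succ n ih =>
    intro M _ _ _ hM
    have ht := torsionless hG (serre_mono (by omega) hM)
    obtain ⟨k, f, hf⟩ := exists_approx (A := R) M
    have hi := approx_inj ht hf
    have hex := LinearMap.exact_map_mkQ_range f
    have hs := Submodule.mkQ_surjective (LinearMap.range f)
    refine Syzn.succ hi hex hs (ih _ ?_)
    intro p c hc h
    obtain ⟨a, b, d⟩ := loc_exact p.asIdeal.primeCompl hi hex hs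
    by_cases h1 : DepthGE (Localization.AtPrime p.asIdeal) (Localization.AtPrime p.asIdeal) (c+1)
    · exact dg_right a b d (dg_proj h) (hM p (c+1) (by omega) h1)
    · obtain ⟨t, ht⟩ := id_loc hG p.asIdeal.primeCompl
      have hb : ID (Localization.AtPrime p.asIdeal) c := ht.bass h1
      have hMc := hM p c (by omega) h
      refine dg_of_ez hb h fun i => ?_
      cases i with
      | zero => exact EZ.one_of_extend a b d (EZ.proj 0) (approx_loc hf _)
      | succ i => exact EZ.con3 a b d (EZ.of_dg' hb hMc (by omega)) (EZ.proj _)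

end Serre
end Hlp

namespace Hlp
section Fin
open IsLocalRing
open Module
set_option linter.unusedSectionVars false
variable {R : Type} [CommRing R]

theorem dual_finite [IsNoetherianRing R] (M : Type) [AddCommGroup M] [Module R M] [Module.Finite R M] :
    Module.Finite R (Dual R M) := inferInstance

theorem EZ.retract {Y M N : Type} [AddCommGroup Y] [Module R Y] [AddCommGroup M] [Module R M]
    [AddCommGroup N] [Module R N] (f : N →ₗ[R] M) (g : M →ₗ[R] N) (hgf : g.comp f = LinearMap.id)
    {i : ℕ} (h : EZ R Y M i) : EZ R Y N i := by
  refine subsingleton_of_forall_eq 0 fun α => ?_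
  have h1 : ModuleCat.ofHom f ≫ ModuleCat.ofHom g = 𝟙 _ := by
    rw [← ModuleCat.ofHom_comp, hgf]; rfl
  have h2 := Abelian.Ext.comp_mk₀_id α
  rw [← h1, ← Abelian.Ext.mk₀_comp_mk₀, ← Abelian.Ext.comp_assoc_of_third_deg_zero] at h2
  rw [← h2, @Subsingleton.elim _ h (α.comp (Abelian.Ext.mk₀ (ModuleCat.ofHom f)) (add_zero i)) 0]
  simp

theorem serre_retract [IsNoetherianRing R] {M N : Type} [AddCommGroup M] [Module R M]
    [AddCommGroup N] [Module R N] [Module.Finite R M] [Module.Finite R N]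
    (f : N →ₗ[R] M) (g : M →ₗ[R] N) (hgf : g.comp f = LinearMap.id) {n : ℕ}
    (h : SerreS R n (ModuleCat.of R M)) : SerreS R n (ModuleCat.of R N) := by
  intro p c hc hA
  have h1 := h p c hc hA
  have : (LocalizedModule.map p.asIdeal.primeCompl g).comp (LocalizedModule.map p.asIdeal.primeCompl f)
      = LinearMap.id := by
    ext x
    induction x using LocalizedModule.induction_on with
    | _ m s =>
      have : g (f m) = m := LinearMap.congr_fun hgf m
      simp [LocalizedModule.map_mk, this]
  exact (dg_iff (M := LocalizedModule p.asIdeal.primeCompl N) c).2 fun i hi =>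
    EZ.retract _ _ this ((dg_iff (M := LocalizedModule p.asIdeal.primeCompl M) c).1 h1 i hi)

theorem approx_dual {M P : ModuleCat.{0} R} {f : M →ₗ[R] P} (hf : IsLeftApprox R f)
    (φ : M →ₗ[R] R) : ∃ ψ : P →ₗ[R] R, ψ.comp f = φ :=
  hf.2 (ModuleCat.of R R) ⟨inferInstanceAs (Module.Finite R R), inferInstanceAs (Module.Projective R R)⟩ φ

theorem cosyz_exact {N K : ModuleCat.{0} R} (h : IsCosyzygy R N K) :
    ∃ (P : ModuleCat.{0} R) (f : K →ₗ[R] P) (π : P →ₗ[R] N), Module.Finite R P ∧ Module.Projective R P ∧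
      Function.Exact f π ∧ Function.Surjective π ∧ ∀ φ : K →ₗ[R] R, ∃ ψ : P →ₗ[R] R, ψ.comp f = φ := by
  obtain ⟨P, f, hf, ⟨e⟩⟩ := h
  refine ⟨P, f, e.symm.toLinearMap.comp (LinearMap.range f).mkQ, hf.1.1, hf.1.2, ?_, ?_, approx_dual hf⟩
  · intro y
    have := LinearMap.exact_map_mkQ_range f y
    rw [← this]; simp
  · exact e.symm.surjective.comp (Submodule.mkQ_surjective _)

theorem cosyz_finite {j : ℕ} (N M : ModuleCat.{0} R) (hM : Module.Finite R M) (h : IsNthCosyzygy R j N M) :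
    Module.Finite R N := by
  cases j with
  | zero => obtain ⟨e⟩ := h; exact Module.Finite.equiv e.symm
  | succ j =>
    obtain ⟨K, hK, h⟩ := h
    obtain ⟨P, f, π, _, _, hex, hπ, hf⟩ := cosyz_exact h
    exact Module.Finite.of_surjective π hπ

theorem cosyz_dual {j : ℕ} (N M : ModuleCat.{0} R) (h : IsNthCosyzygy R j N M) :
    IsNthSyzygy R j (ModuleCat.of R (Dual R N)) (ModuleCat.of R (Dual R M)) := by
  induction j generalizing N with
  | zero => obtain ⟨e⟩ := h; exact ⟨e.symm.dualMap⟩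
  | succ j ih =>
    obtain ⟨K, hK, h⟩ := h
    obtain ⟨P, f, π, _, _, hex, hπ, hf⟩ := cosyz_exact h
    obtain ⟨h1, h2⟩ := dual_exact hex hπ
    exact ⟨_, ih K hK, isSyz_of_exact h1 h2 hf⟩

theorem dual_syz2 [IsNoetherianRing R] (M : Type) [AddCommGroup M] [Module R M] [Module.Finite R M] :
    Syzn R 2 (Dual R M) := by
  obtain ⟨k, f, hf⟩ := Module.Finite.exists_fin' R M
  obtain ⟨m, g, hg⟩ := Module.Finite.exists_fin' R (LinearMap.ker f)
  have hex : Function.Exact ((LinearMap.ker f).subtype.comp g) f := by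
    rw [LinearMap.exact_iff, LinearMap.range_comp, LinearMap.range_eq_top.2 hg]; simp
  obtain ⟨h1, h2⟩ := dual_exact hex hf
  set d := ((LinearMap.ker f).subtype.comp g)
  have h3 : Syzn R 1 (LinearMap.range d.dualMap) :=
    Syzn.succ (LinearMap.range d.dualMap).subtype_injective
      (LinearMap.exact_subtype_mkQ _) (Submodule.mkQ_surjective _)
      ⟨ModuleCat.of R (Dual R (Fin m → R) ⧸ LinearMap.range d.dualMap),
        inferInstanceAs (Module.Finite R (Dual R (Fin m → R) ⧸ LinearMap.range d.dualMap)), ⟨LinearEquiv.refl _ _⟩⟩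
  refine Syzn.succ (g := d.dualMap.rangeRestrict) h1 ?_ d.dualMap.surjective_rangeRestrict h3
  intro ψ
  rw [← h2 ψ, Subtype.ext_iff]; rfl

theorem cosyz_torsionless [IsNoetherianRing R] {d : ℕ} (hd : 1 < d) (hR : ID R d) {i : ℕ} (hi : d ≤ i)
    (N M : ModuleCat.{0} R) (hM : Module.Finite R M) (h : IsNthCosyzygy R i N M) :
    Function.Injective (Dual.eval R N) := by
  obtain ⟨j, rfl⟩ : ∃ j, i = j + 2 := ⟨i-2, by omega⟩
  obtain ⟨N1, ⟨N0, h0, hN1⟩, hN⟩ := h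
  obtain ⟨P, f, π, _, _, hex, hπ, hf⟩ := cosyz_exact hN
  refine inj_eval hex hπ hf ?_
  obtain ⟨Q, f', π', _, _, hex', hπ', hf'⟩ := cosyz_exact hN1
  refine surj_eval π' fun ξ => ?_
  obtain ⟨h1, h2⟩ := dual_exact hex' hπ'
  refine EZ.extend h1 h2 hf' ?_ ξ
  have hs := cosyz_dual N0 M h0
  refine EZ.syz_up (i := 0) hs ?_
  obtain ⟨X, hX, h'⟩ := dual_syz2 (R := R) M
  have : EZ R (Dual R M) R (j+1) := EZ.syz_up h' (hR X _ (by omega))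
  rw [show 0 + 1 + j = j + 1 by omega]
  exact this

theorem cosyz_syz [IsNoetherianRing R] {d : ℕ} (hd : 1 < d) (hR : ID R d) (n : ℕ) {i : ℕ} (hi : d ≤ i)
    (N M : ModuleCat.{0} R) (hM : Module.Finite R M) (h : IsNthCosyzygy R i N M) : Syzn R n N := by
  have hN := cosyz_finite N M hM h
  induction n generalizing i N with
  | zero => exact ⟨N, hN, ⟨LinearEquiv.refl _ _⟩⟩
  | succ n ih =>
    obtain ⟨k, f, hf⟩ := exists_approx (A := R) N
    have hi' := approx_inj (cosyz_torsionless hd hR hi N M hM h) hf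
    refine Syzn.succ hi' (LinearMap.exact_map_mkQ_range f) (Submodule.mkQ_surjective _)
      (ih (i := i+1) (by omega) (ModuleCat.of R ((Fin k → R) ⧸ LinearMap.range f)) ?_
        (inferInstanceAs (Module.Finite R ((Fin k → R) ⧸ LinearMap.range f))))
    refine ⟨N, h, ModuleCat.of R (Fin k → R), f, ⟨⟨inferInstanceAs (Module.Finite R (Fin k → R)),
      inferInstanceAs (Module.Projective R (Fin k → R))⟩, ?_⟩, ⟨LinearEquiv.refl _ _⟩⟩
    rintro Q ⟨_, _⟩ g
    exact approx_proj hf g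

end Fin
end Hlp

/-- over a Gorenstein local ring of dimension `d > 1` and `0 < n < d`,
the modules satisfying `(S̃_n)` are exactly the `n`-th syzygy modules; they form a
resolving subcategory strictly containing the totally reflexive modules and closed
under `Ω⁻ⁱ` for all `i ≥ d`. -/
theorem stmt19 (R : Type) [CommRing R] [IsNoetherianRing R] [IsLocalRing R]
    (hGor : Gorenstein R) (d n : ℕ)
    (hdim : ringKrullDim R = (d : ℕ)) (hd : 1 < d) (hn0 : 0 < n) (hnd : n < d) :
    (∀ M : ModuleCat.{0} R, Module.Finite R M →
      (SerreS R n M ↔ ∃ N : ModuleCat.{0} R, Module.Finite R N ∧ IsNthSyzygy R n M N)) ∧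
    Resolving R (fun M => Module.Finite R M ∧ SerreS R n M) ∧
    (∀ M : ModuleCat.{0} R, Module.Finite R M → TotallyReflexive R M → SerreS R n M) ∧
    (∃ M : ModuleCat.{0} R, Module.Finite R M ∧ SerreS R n M ∧ ¬ TotallyReflexive R M) ∧
    (∀ i, d ≤ i → ∀ M : ModuleCat.{0} R, Module.Finite R M → SerreS R n M →
      ∀ N, IsNthCosyzygy R i N M → (Module.Finite R N ∧ SerreS R n N)) := by
  obtain ⟨t, ht⟩ := Hlp.gor_injdim hGor
  obtain ⟨hdep, hndep, hid⟩ := (Hlp.id_of_injdim ht).depth_eq hdim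
  have p1 : ∀ M : ModuleCat.{0} R, Module.Finite R M →
      (SerreS R n M ↔ ∃ N : ModuleCat.{0} R, Module.Finite R N ∧ IsNthSyzygy R n M N) := by
    intro M hM
    constructor
    · intro h
      exact Hlp.syz_of_serre hGor n M h
    · rintro ⟨N, hN, h⟩
      exact Hlp.serre_of_syz M N hN h
  refine ⟨p1, ⟨fun M h => h.1, ?_, ?_, ?_, ?_⟩, ?_, ?_, ?_⟩
  · rintro M ⟨h1, h2⟩
    exact ⟨h1, Hlp.serre_proj (M := M) n⟩
  · rintro M N N' ⟨h1, h2⟩ ⟨e⟩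
    have hN : Module.Finite R N := Module.Finite.of_surjective
      ((LinearMap.fst R N N').comp e.toLinearMap) ((LinearMap.fst_surjective (R := R) (M := N) (M₂ := N')).comp e.surjective)
    refine ⟨hN, Hlp.serre_retract (M := M) (e.symm.toLinearMap.comp (LinearMap.inl R N N'))
      ((LinearMap.fst R N N').comp e.toLinearMap) ?_ h2⟩
    ext x; simp
  · rintro L M N f g ⟨hf, hg, hfg⟩ ⟨hL, hL'⟩ ⟨hN, hN'⟩
    have hex : Function.Exact f g := LinearMap.exact_iff.2 hfg
    have hM : Module.Finite R M := by
      have : IsNoetherian R M := isNoetherian_of_range_eq_ker f g hfg.symm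
      infer_instance
    exact ⟨hM, Hlp.serre_mid hf hex hg hL' hN'⟩
  · rintro L M N f g ⟨hf, hg, hfg⟩ ⟨hM, hM'⟩ ⟨hN, hN'⟩
    have hex : Function.Exact f g := LinearMap.exact_iff.2 hfg
    have hL : Module.Finite R L := Module.Finite.of_injective f hf
    obtain ⟨m, rfl⟩ : ∃ m, n = m + 1 := ⟨n - 1, by omega⟩
    exact ⟨hL, Hlp.serre_left hf hex hg hM' (Hlp.serre_mono (by omega) hN')⟩
  · rintro M hM ⟨hbij, hext⟩
    have h1 : ∀ i, Hlp.EZ R (Module.Dual R M) R (i+1) := fun i =>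
      (Hlp.extVanish_iff R _ _ i).1 (hext (i+1) (by omega)).2
    have hfin : Module.Finite R (Module.Dual R M) := Hlp.dual_finite M
    exact (p1 M hM).2 ((Hlp.lemD n _ h1).congr (LinearEquiv.ofBijective _ hbij).symm)
  · obtain ⟨M, hM, hs⟩ := Hlp.exists_syz n (ModuleCat.of R (R ⧸ IsLocalRing.maximalIdeal R))
    refine ⟨M, hM, Hlp.serre_of_syz M _ inferInstance hs, ?_⟩
    rintro ⟨-, hext⟩
    have h1 : Hlp.EZ R M R ((d - n - 1)+1) :=
      (Hlp.extVanish_iff R M (ModuleCat.of R R) _).1 (hext _ (by omega)).1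
    have h2 : Hlp.EZ R (R ⧸ IsLocalRing.maximalIdeal R) R (d - n - 1 + 1 + n) := Hlp.EZ.syz_down hs h1
    rw [show d - n - 1 + 1 + n = d by omega] at h2
    refine hndep ((Hlp.dg_iff (d+1)).2 fun i hi => ?_)
    rcases (show i < d ∨ i = d by omega) with hi | rfl
    · exact (Hlp.dg_iff d).1 hdep i hi
    · exact h2
  · intro i hi M hM _ N hN
    have hNf := Hlp.cosyz_finite N M hM hN
    exact ⟨hNf, (p1 N hNf).2 (Hlp.cosyz_syz hd hid n hi N M hM hN)⟩
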